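/- Let G be a finite simple graph on n vertices with adjacency matrix A. If LCP(G) is w-unique, i.e. the vector (A+I)x − e is the same for every x ∈ SOL(G), then eᵀx is constant over SOL(G); in particular, all maximal independent sets of G then have the same cardinality, so G is well-covered. -/

import Mathlib

open Matrix Finset

/-- `x` solves the linear complementarity problem `LCP(A + I, -e)`, where `A` is the
adjacency matrix of the simple graph `G`, `I` is the identity matrix and `e` is the
all-ones vector: `x ≥ 0`, `(A+I)x ≥ e`, and `xᵀ((A+I)x − e) = 0`. -/
def SolLCP {V : Type*} [Fintype V] [DecidableEq V] (G : SimpleGraph V) [DecidableRel G.Adj]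
    (x : V → ℝ) : Prop :=
  (∀ i, 0 ≤ x i) ∧
  (∀ i, 1 ≤ ((G.adjMatrix ℝ + 1) *ᵥ x) i) ∧
  ∑ i, x i * (((G.adjMatrix ℝ + 1) *ᵥ x) i - 1) = 0

/-- `S` is an independent set of the simple graph `G`: its vertices are pairwise nonadjacent. -/
def IsIndepFinset {V : Type*} (G : SimpleGraph V) (S : Finset V) : Prop :=
  ∀ i ∈ S, ∀ j ∈ S, ¬ G.Adj i j

/-- `S` is a maximal independent set of `G`: it is independent and is not properly
contained in any larger independent set. -/
def IsMaxIndepFinset {V : Type*} (G : SimpleGraph V) (S : Finset V) : Prop :=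
  IsIndepFinset G S ∧ ∀ T : Finset V, IsIndepFinset G T → S ⊆ T → S = T

theorem adjMatrix_add_one_mulVec_apply {V : Type*} [Fintype V] [DecidableEq V]
    (G : SimpleGraph V) [DecidableRel G.Adj] (x : V → ℝ) (i : V) :
    ((G.adjMatrix ℝ + 1) *ᵥ x) i = ∑ j ∈ G.neighborFinset i, x j + x i := by
  rw [add_mulVec, one_mulVec, Pi.add_apply, SimpleGraph.adjMatrix_mulVec_apply]

/-- Two solutions of `LCP(G)` with the same slack vector have the same coordinate sum. -/
theorem SolLCP.sum_eq_of_mulVec_eq {V : Type*} [Fintype V] [DecidableEq V]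
    {G : SimpleGraph V} [DecidableRel G.Adj] {x y : V → ℝ}
    (hx : SolLCP G x) (hy : SolLCP G y)
    (h : (G.adjMatrix ℝ + 1) *ᵥ x = (G.adjMatrix ℝ + 1) *ᵥ y) :
    ∑ i, x i = ∑ i, y i := by
  have sum_eq_dotProduct : ∀ z, SolLCP G z → ∑ i, z i = z ⬝ᵥ ((G.adjMatrix ℝ + 1) *ᵥ z) := by
    rintro z ⟨-, -, hz⟩
    simp only [mul_sub, mul_one, Finset.sum_sub_distrib] at hz
    simp only [dotProduct]
    linarith
  have symm : (G.adjMatrix ℝ + 1)ᵀ = G.adjMatrix ℝ + 1 := by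
    rw [transpose_add, SimpleGraph.transpose_adjMatrix, transpose_one]
  rw [sum_eq_dotProduct x hx, sum_eq_dotProduct y hy, h, dotProduct_mulVec,
    ← mulVec_transpose, symm, h, dotProduct_comm]

theorem IsMaxIndepFinset.exists_adj {V : Type*} {G : SimpleGraph V} {S : Finset V}
    (hS : IsMaxIndepFinset G S) {i : V} (hi : i ∉ S) : ∃ j ∈ S, G.Adj i j := by
  classical
  by_contra! hadj
  have hins : IsIndepFinset G (insert i S) := by
    intro a ha b hb hab
    rcases Finset.mem_insert.1 ha with rfl | haS <;>
      rcases Finset.mem_insert.1 hb with rfl | hbS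
    · exact G.irrefl hab
    · exact hadj b hbS hab
    · exact hadj a haS hab.symm
    · exact hS.1 a haS b hbS hab
  exact hi (hS.2 _ hins (Finset.subset_insert i S) ▸ Finset.mem_insert_self i S)

/-- The indicator vector of a maximal independent set solves `LCP(G)`. -/
theorem IsMaxIndepFinset.solLCP_indicator {V : Type*} [Fintype V] [DecidableEq V]
    {G : SimpleGraph V} [DecidableRel G.Adj] {S : Finset V} (hS : IsMaxIndepFinset G S) :
    SolLCP G (fun i => if i ∈ S then 1 else 0) := by
  have hnonneg : ∀ i : V, (0 : ℝ) ≤ if i ∈ S then 1 else 0 := fun i => by split_ifs <;> norm_num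
  have hmem : ∀ i ∈ S,
      ((G.adjMatrix ℝ + 1) *ᵥ (fun i => if i ∈ S then (1 : ℝ) else 0)) i = 1 := by
    intro i hi
    rw [adjMatrix_add_one_mulVec_apply, Finset.sum_eq_zero, if_pos hi, zero_add]
    intro j hj
    exact if_neg fun hjS => hS.1 i hi j hjS ((G.mem_neighborFinset i j).1 hj)
  refine ⟨hnonneg, fun i => ?_, Finset.sum_eq_zero fun i _ => ?_⟩
  · by_cases hi : i ∈ S
    · exact (hmem i hi).ge
    · obtain ⟨j, hjS, hij⟩ := hS.exists_adj hi
      rw [adjMatrix_add_one_mulVec_apply, if_neg hi, add_zero]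
      have hle := Finset.single_le_sum (f := fun j => if j ∈ S then (1 : ℝ) else 0)
        (fun k _ => hnonneg k) ((G.mem_neighborFinset i j).2 hij)
      simpa only [if_pos hjS] using hle
  · by_cases hi : i ∈ S
    · rw [hmem i hi, sub_self, mul_zero]
    · simp only [if_neg hi, zero_mul]

/-- If `LCP(G)` is w-unique, i.e. the vector `(A+I)x − e` is the same for every solution
`x` of `LCP(G)`, then `eᵀx` is constant over the solution set; in particular all maximal
independent sets of `G` have the same cardinality, so `G` is well-covered. -/
theorem stmt_19 {n : ℕ} (G : SimpleGraph (Fin n)) [DecidableRel G.Adj]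
    (hw : ∀ x y : Fin n → ℝ, SolLCP G x → SolLCP G y →
      (fun i => ((G.adjMatrix ℝ + 1) *ᵥ x) i - 1) =
        (fun i => ((G.adjMatrix ℝ + 1) *ᵥ y) i - 1)) :
    (∃ c : ℝ, ∀ x : Fin n → ℝ, SolLCP G x → ∑ i, x i = c) ∧
    ∀ S T : Finset (Fin n), IsMaxIndepFinset G S → IsMaxIndepFinset G T →
      S.card = T.card := by
  have hsum : ∀ x y : Fin n → ℝ, SolLCP G x → SolLCP G y → ∑ i, x i = ∑ i, y i :=
    fun x y hx hy => hx.sum_eq_of_mulVec_eq hy <|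
      funext fun i => sub_left_injective (congrFun (hw x y hx hy) i)
  refine ⟨?_, fun S T hS hT => ?_⟩
  · by_cases hex : ∃ y, SolLCP G y
    · obtain ⟨y, hy⟩ := hex
      exact ⟨∑ i, y i, fun x hx => hsum x y hx hy⟩
    · exact ⟨0, fun x hx => absurd ⟨x, hx⟩ hex⟩
  · have hcard := hsum _ _ hS.solLCP_indicator hT.solLCP_indicator
    simpa using hcard
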